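/- arXiv:2104.01994 — 3 statements merged into one kernel-verified Lean document; each statement's English description precedes it below -/
import Mathlib

section
/- Second quadratic relation of the hidden symmetry algebra: with t₁ = (q + q⁻¹)²·a₂·b₁ (a scalar) and t₀ = (q + q⁻¹)·(a₂·Q_B·(k_A·k_B)⁻¹ + b₁·Q_A·k_A·k_B), the symmetry operators K₁ and K₂ satisfy K₂²·K₁ + K₁·K₂² − (q² + q⁻²)·K₂·K₁·K₂ + (q − q⁻¹)²·(p₁·K₂ + t₁·K₁ + t₀) = 0. -/
/-- A relation `k * x = c • (x * k)` passes to the inverse of `k`. -/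
theorem inv_mul_eq_smul_of_mul_eq_smul {R : Type*} [Ring R] [Algebra ℂ R] {c : ℂ} (hc : c ≠ 0)
    {k kinv x : R} (hk : k * kinv = 1) (hk' : kinv * k = 1) (h : k * x = c • (x * k)) :
    kinv * x = c⁻¹ • (x * kinv) := by
  have h' : x * kinv = c • (kinv * x) := by
    calc x * kinv = kinv * (k * x) * kinv := by rw [← mul_assoc, hk', one_mul]
      _ = c • (kinv * x * (k * kinv)) := by
        rw [h, mul_smul_comm, smul_mul_assoc]; simp only [mul_assoc]
      _ = c • (kinv * x) := by rw [hk, mul_one]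
  rw [h', smul_smul, inv_mul_cancel₀ hc, one_smul]

section Casimir

variable {R : Type*} [Ring R] [Algebra ℂ R] {q a₂ a₁ : ℂ} {k kinv P M Q : R}

theorem lower_mul_raise
    (h3 : M * P - P * M = (q - q⁻¹) • (a₁ • k ^ 2 - a₂ • kinv ^ 2))
    (hQ : Q = P * M - (a₁ * q⁻¹) • k ^ 2 - (a₂ * q) • kinv ^ 2) :
    M * P = Q + (a₁ * q) • (k * k) + (a₂ * q⁻¹) • (kinv * kinv) := by
  rw [sub_eq_iff_eq_add.mp h3, hQ]
  simp only [sq]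
  module

theorem casimir_commute_weight (hq : q ≠ 0) (hk : k * kinv = 1) (hk' : kinv * k = 1)
    (h1 : k * P = q • (P * k)) (h2 : k * M = q⁻¹ • (M * k))
    (hQ : Q = P * M - (a₁ * q⁻¹) • k ^ 2 - (a₂ * q) • kinv ^ 2) : Commute Q k := by
  have hPM : Commute (P * M) k := by
    show P * M * k = k * (P * M)
    rw [← mul_assoc, h1, smul_mul_assoc, mul_assoc, mul_assoc, h2, mul_smul_comm, smul_smul,
      mul_inv_cancel₀ hq, one_smul]
  have hkk : Commute kinv k := by rw [commute_iff_eq, hk, hk']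
  rw [hQ]
  exact (hPM.sub_left (((Commute.refl k).pow_left 2).smul_left _)).sub_left
    ((hkk.pow_left 2).smul_left _)

theorem casimir_commute_raise (hq : q ≠ 0) (hk : k * kinv = 1) (hk' : kinv * k = 1)
    (h1 : k * P = q • (P * k))
    (h3 : M * P - P * M = (q - q⁻¹) • (a₁ • k ^ 2 - a₂ • kinv ^ 2))
    (hQ : Q = P * M - (a₁ * q⁻¹) • k ^ 2 - (a₂ * q) • kinv ^ 2) : Commute Q P := by
  have hMP := lower_mul_raise h3 hQ
  have hPM : P * M = Q + (a₁ * q⁻¹) • (k * k) + (a₂ * q) • (kinv * kinv) := by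
    rw [hQ]; simp only [sq]; module
  have h1' := inv_mul_eq_smul_of_mul_eq_smul hq hk hk' h1
  have e1 : k * k * P = (q * q) • (P * (k * k)) := by
    rw [mul_assoc, h1, mul_smul_comm, ← mul_assoc, h1, smul_mul_assoc, smul_smul, mul_assoc]
  have e2 : kinv * kinv * P = (q⁻¹ * q⁻¹) • (P * (kinv * kinv)) := by
    rw [mul_assoc, h1', mul_smul_comm, ← mul_assoc, h1', smul_mul_assoc, smul_smul, mul_assoc]
  have e : P * M * P = P * (M * P) := mul_assoc _ _ _
  rw [hPM, hMP, add_mul, add_mul, mul_add, mul_add, smul_mul_assoc, smul_mul_assoc, e1, e2,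
    mul_smul_comm, mul_smul_comm, smul_smul, smul_smul] at e
  rw [show a₁ * q⁻¹ * (q * q) = a₁ * q by field_simp,
    show a₂ * q * (q⁻¹ * q⁻¹) = a₂ * q⁻¹ by field_simp] at e
  exact add_right_cancel (add_right_cancel e)

theorem casimir_commute_lower (hq : q ≠ 0) (hk : k * kinv = 1) (hk' : kinv * k = 1)
    (h2 : k * M = q⁻¹ • (M * k))
    (h3 : M * P - P * M = (q - q⁻¹) • (a₁ • k ^ 2 - a₂ • kinv ^ 2))
    (hQ : Q = P * M - (a₁ * q⁻¹) • k ^ 2 - (a₂ * q) • kinv ^ 2) : Commute Q M := by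
  have hMP := lower_mul_raise h3 hQ
  have hPM : P * M = Q + (a₁ * q⁻¹) • (k * k) + (a₂ * q) • (kinv * kinv) := by
    rw [hQ]; simp only [sq]; module
  have h2' := inv_mul_eq_smul_of_mul_eq_smul (inv_ne_zero hq) hk hk' h2
  rw [inv_inv] at h2'
  have e1 : k * k * M = (q⁻¹ * q⁻¹) • (M * (k * k)) := by
    rw [mul_assoc, h2, mul_smul_comm, ← mul_assoc, h2, smul_mul_assoc, smul_smul, mul_assoc]
  have e2 : kinv * kinv * M = (q * q) • (M * (kinv * kinv)) := by
    rw [mul_assoc, h2', mul_smul_comm, ← mul_assoc, h2', smul_mul_assoc, smul_smul, mul_assoc]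
  have e : M * P * M = M * (P * M) := mul_assoc _ _ _
  rw [hPM, hMP, add_mul, add_mul, mul_add, mul_add, smul_mul_assoc, smul_mul_assoc, e1, e2,
    mul_smul_comm, mul_smul_comm, smul_smul, smul_smul] at e
  rw [show a₁ * q * (q⁻¹ * q⁻¹) = a₁ * q⁻¹ by field_simp,
    show a₂ * q⁻¹ * (q * q) = a₂ * q by field_simp] at e
  exact add_right_cancel (add_right_cancel e)

end Casimir

/-- The second Askey-Wilson relation for `K₂ = p L + p₂ L² + X + Y`, where `L` is the inverse of
`K`, `p` commutes with `K`, `L`, `X`, `Y`, and `K` rescales `X` and `Y` by opposite weights. -/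
theorem askeyWilson_of_tridiagonal {R : Type*} [Ring R] [Algebra ℂ R] {q d e : ℂ} (hq : q ≠ 0)
    {K L X Y p r s : R} (hKL : K * L = 1) (hLK : L * K = 1)
    (hLX : L * X = (q ^ 2) • (X * L)) (hLY : L * Y = ((q ^ 2)⁻¹) • (Y * L))
    (hpK : Commute p K) (hpL : Commute p L) (hpX : Commute p X) (hpY : Commute p Y)
    (hrK : Commute r K) (hsK : Commute s K)
    (hXY : X * Y = (q⁻¹ ^ 2) • (s * (L * L) + (q⁻¹ * d) • (p * (L * (L * L))) + q • (r * L)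
      + (q⁻¹ ^ 2 * d ^ 2) • (L * (L * (L * L))) + (q ^ 2 * e) • (1 : R)))
    (hYX : Y * X = (q ^ 2) • (s * (L * L) + (q * d) • (p * (L * (L * L))) + q⁻¹ • (r * L)
      + (q ^ 2 * d ^ 2) • (L * (L * (L * L))) + (q⁻¹ ^ 2 * e) • (1 : R)))
    {K₂ : R} (hK₂ : K₂ = p * L + ((q + q⁻¹) * d) • (L * L) + X + Y) :
    K₂ ^ 2 * K + K * K₂ ^ 2 - (q ^ 2 + (q⁻¹) ^ 2) • (K₂ * K * K₂)
      + ((q - q⁻¹) ^ 2) • (p * K₂ + ((q + q⁻¹) ^ 2 * e) • K + (q + q⁻¹) • r) = 0 := by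
  have hq2 : q ^ 2 ≠ 0 := pow_ne_zero 2 hq
  have hKX := inv_mul_eq_smul_of_mul_eq_smul hq2 hLK hKL hLX
  have hKY := inv_mul_eq_smul_of_mul_eq_smul (inv_ne_zero hq2) hLK hKL hLY
  have assoc : ∀ {x y z : R}, x * y = z → ∀ w, x * (y * w) = z * w := by
    rintro x y z rfl w; rw [mul_assoc]
  have hKp := hpK.eq.symm
  have hLp := hpL.eq.symm
  have hXp := hpX.eq.symm
  have hYp := hpY.eq.symm
  have hKr := hrK.eq.symm
  have hKs := hsK.eq.symm
  rw [hK₂]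
  simp only [sq (_ + _ : R), mul_add, add_mul, mul_assoc, smul_mul_assoc, mul_smul_comm, smul_add,
    smul_smul, one_mul, mul_one, hKL, hLK, hLX, hLY, hKX, hKY, hXp, hYp,
    hXY, hYX, assoc hKL, assoc hLX, assoc hLY, assoc hKX, assoc hKY, assoc hKp,
    assoc hLp, assoc hXp, assoc hYp, assoc hKr, assoc hKs, assoc hXY, assoc hYX]
  match_scalars <;> field_simp <;> ring

theorem second_AW_relation {R : Type*} [Ring R] [Algebra ℂ R]
    (q : ℂ) (hq : q ≠ 0) (hq2 : q ^ 2 ≠ 1)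
    (a₂ d b₁ : ℂ)
    (kA kAinv Ap Am kB kBinv Bp Bm : R)
    (hkA : kA * kAinv = 1) (hkA' : kAinv * kA = 1)
    (hkB : kB * kBinv = 1) (hkB' : kBinv * kB = 1)
    (hA1 : kA * Ap = q • (Ap * kA))
    (hA2 : kA * Am = q⁻¹ • (Am * kA))
    (hA3 : Am * Ap - Ap * Am = (q - q⁻¹) • (d • kA ^ 2 - a₂ • kAinv ^ 2))
    (hB1 : kB * Bp = q • (Bp * kB))
    (hB2 : kB * Bm = q⁻¹ • (Bm * kB))
    (hB3 : Bm * Bp - Bp * Bm = (q - q⁻¹) • (b₁ • kB ^ 2 - d • kBinv ^ 2))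
    (hcomm : ∀ x ∈ ({kA, kAinv, Ap, Am} : Set R),
             ∀ y ∈ ({kB, kBinv, Bp, Bm} : Set R), Commute x y)
    (QA QB : R)
    (hQA : QA = Ap * Am - (d * q⁻¹) • kA ^ 2 - (a₂ * q) • kAinv ^ 2)
    (hQB : QB = Bp * Bm - (b₁ * q⁻¹) • kB ^ 2 - (d * q) • kBinv ^ 2)
    (K₁ K₂ : R)
    (hK1 : K₁ = kAinv * kB)
    (hK2 : K₂ = (Ap * kBinv + Bp * kA) * (Am * kBinv + Bm * kA)
      - (b₁ * q⁻¹) • (kA * kB) ^ 2 - (a₂ * q) • (kAinv * kBinv) ^ 2)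
    (p₂ : ℂ) (hp2 : p₂ = (q + q⁻¹) * d)
    (p₁ : R) (hp1 : p₁ = QB * (kA * kB) + QA * (kAinv * kBinv))
    (t₁ : ℂ) (ht1 : t₁ = (q + q⁻¹) ^ 2 * a₂ * b₁)
    (t₀ : R) (ht0 : t₀ = (q + q⁻¹) • (a₂ • (QB * (kAinv * kBinv)) + b₁ • (QA * (kA * kB)))) :
    K₂ ^ 2 * K₁ + K₁ * K₂ ^ 2 - (q ^ 2 + (q⁻¹) ^ 2) • (K₂ * K₁ * K₂)
      + ((q - q⁻¹) ^ 2) • (p₁ * K₂ + t₁ • K₁ + t₀) = 0 := by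
  have hC : ∀ x ∈ ({kA, kAinv, Ap, Am} : Set R),
      ∀ y ∈ ({kB, kBinv, Bp, Bm} : Set R), y * x = x * y :=
    fun x hx y hy => (hcomm x hx y hy).eq.symm
  simp only [Set.mem_insert_iff, Set.mem_singleton_iff, forall_eq_or_imp, forall_eq] at hC
  obtain ⟨⟨c1, c2, c3, c4⟩, ⟨c5, c6, c7, c8⟩, ⟨c9, c10, c11, c12⟩, c13, c14, c15, c16⟩ := hC
  have hqi : q⁻¹ ≠ 0 := inv_ne_zero hq
  have hA1' := inv_mul_eq_smul_of_mul_eq_smul hq hkA hkA' hA1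
  have hA2' := inv_mul_eq_smul_of_mul_eq_smul hqi hkA hkA' hA2
  have hB1' := inv_mul_eq_smul_of_mul_eq_smul hq hkB hkB' hB1
  have hB2' := inv_mul_eq_smul_of_mul_eq_smul hqi hkB hkB' hB2
  rw [inv_inv] at hA2' hB2'
  have hAMP := lower_mul_raise hA3 hQA
  have hBMP := lower_mul_raise hB3 hQB
  have hAPM : Ap * Am = QA + (d * q⁻¹) • (kA * kA) + (a₂ * q) • (kAinv * kAinv) := by
    rw [hQA]; simp only [sq]; module
  have hBPM : Bp * Bm = QB + (b₁ * q⁻¹) • (kB * kB) + (d * q) • (kBinv * kBinv) := by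
    rw [hQB]; simp only [sq]; module
  have QAk := casimir_commute_weight hq hkA hkA' hA1 hA2 hQA
  have QBk := casimir_commute_weight hq hkB hkB' hB1 hB2 hQB
  have QAki : Commute QA kAinv := QAk.units_inv_right (u := ⟨kA, kAinv, hkA, hkA'⟩)
  have QBki : Commute QB kBinv := QBk.units_inv_right (u := ⟨kB, kBinv, hkB, hkB'⟩)
  have QAP := casimir_commute_raise hq hkA hkA' hA1 hA3 hQA
  have QBP := casimir_commute_raise hq hkB hkB' hB1 hB3 hQB
  have QAM := casimir_commute_lower hq hkA hkA' hA2 hA3 hQA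
  have QBM := casimir_commute_lower hq hkB hkB' hB2 hB3 hQB
  have hAQ : ∀ y ∈ ({kB, kBinv, Bp, Bm} : Set R), Commute QA y := by
    intro y hy
    have h := fun x hx => hcomm x hx y hy
    rw [hQA]
    exact ((((h Ap (by simp)).mul_left (h Am (by simp))).sub_left
      (((h kA (by simp)).pow_left 2).smul_left _))).sub_left
      (((h kAinv (by simp)).pow_left 2).smul_left _)
  have hBQ : ∀ x ∈ ({kA, kAinv, Ap, Am} : Set R), Commute QB x := by
    intro x hx
    have h := fun y hy => (hcomm x hx y hy).symm
    rw [hQB]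
    exact ((((h Bp (by simp)).mul_left (h Bm (by simp))).sub_left
      (((h kB (by simp)).pow_left 2).smul_left _))).sub_left
      (((h kBinv (by simp)).pow_left 2).smul_left _)
  have hQQ : QB * QA = QA * QB := by
    have h := fun y hy => (hAQ y hy).symm
    rw [← commute_iff_eq]
    nth_rw 1 [hQB]
    exact ((((h Bp (by simp)).mul_left (h Bm (by simp))).sub_left
      (((h kB (by simp)).pow_left 2).smul_left _))).sub_left
      (((h kBinv (by simp)).pow_left 2).smul_left _)
  replace hAQ := fun y hy => (hAQ y hy).eq.symm
  replace hBQ := fun y hy => (hBQ y hy).eq.symm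
  simp only [Set.mem_insert_iff, Set.mem_singleton_iff, forall_eq_or_imp, forall_eq] at hAQ hBQ
  obtain ⟨e1, e2, e3, e4⟩ := hAQ
  obtain ⟨f1, f2, f3, f4⟩ := hBQ
  replace QAk := QAk.eq.symm
  replace QBk := QBk.eq.symm
  replace QAki := QAki.eq.symm
  replace QBki := QBki.eq.symm
  replace QAP := QAP.eq.symm
  replace QBP := QBP.eq.symm
  replace QAM := QAM.eq.symm
  replace QBM := QBM.eq.symm
  clear hQA hQB hcomm hA3 hB3
  have assoc : ∀ {x y z : R}, x * y = z → ∀ w, x * (y * w) = z * w := by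
    rintro x y z rfl w; rw [mul_assoc]
  have key := askeyWilson_of_tridiagonal (R := R) (d := d) (e := a₂ * b₁) hq (K := kAinv * kB)
    (L := kA * kBinv) (X := q • (Ap * (Bm * (kA * kBinv))))
    (Y := q⁻¹ • (Am * (Bp * (kA * kBinv)))) (p := p₁)
    (r := a₂ • (QB * (kAinv * kBinv)) + b₁ • (QA * (kA * kB)))
    (s := QA * QB + (d * b₁) • (kA * kB) ^ 2 + (a₂ * d) • (kAinv * kBinv) ^ 2)
    (K₂ := K₂)
  subst hp1 hK1 hK2 ht0 ht1
  simp only [← mul_assoc ((q + q⁻¹) ^ 2)] at key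
  apply key
  -- Normal order: `QA`, `QB`, then `Ap`, `Am`, `Bp`, `Bm`, then the weights of `A` and of `B`.
  all_goals
    try rw [commute_iff_eq]
    simp only [sq (_ * _ : R), mul_add, add_mul, mul_assoc, smul_mul_assoc, mul_smul_comm, smul_add,
      smul_smul, one_mul, mul_one, c3, c4, c6, hB2', hBPM, QBk, f1, hkA, hkA', hkB, hkB', assoc c1,
      assoc c2, assoc c3, assoc c4, assoc c5, assoc c6, assoc c7, assoc c8, assoc c9, assoc c10,
      assoc c11, assoc c13, assoc c14, assoc c15, assoc c16, assoc hA1, assoc hA2, assoc hA1',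
      assoc hA2', assoc hB1, assoc hB2, assoc hB1', assoc hB2', assoc hAMP, assoc hBMP, assoc hAPM,
      assoc hBPM, assoc QAk, assoc QBk, assoc QAki, assoc QBki, assoc QAP, assoc QBP, assoc QAM,
      assoc QBM, assoc hQQ, assoc e1, assoc e2, assoc e3, assoc e4, assoc f1, assoc f2, assoc f3,
      assoc f4, assoc hkA, assoc hkA', assoc hkB]
  all_goals match_scalars <;> field_simp <;> ring
end

section
/- Hidden symmetry for the sum eu_q^− ⊕ eu_q^+ = M(2): in the special case a₂ = 0 and b₁ = 0 (so that the first triple is a (0,d)-triple and the second a (d,0)-triple), one has q·K₂·K₃ − q⁻¹·K₃·K₂ = B·K₂ and q·K₃·K₁ − q⁻¹·K₁·K₃ = B·K₁ + D₂·1, where K₃ = q·K₁·K₂ − q⁻¹·K₂·K₁, B = (q − q⁻¹)²·(Q_B·k_A·k_B + Q_A·(k_A·k_B)⁻¹), and D₂ = (q − q⁻¹)²·(q + q⁻¹)·d; i.e. the structure constants C₁ and D₁ vanish. -/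
/-- A rewriting rule for a product of two factors, in the form that applies inside a
right-associated word. -/
theorem mul_mul_eq_of_mul_eq {M : Type*} [Semigroup M] {a b r : M} (h : a * b = r) (c : M) :
    a * (b * c) = r * c := by
  rw [← mul_assoc, h]

/-- A `q`-commutation relation with an invertible element passes to its inverse. -/
theorem inv_mul_of_mul_eq_smul {R : Type*} [Ring R] [Algebra ℂ R] {q : ℂ} (hq : q ≠ 0)
    {k k' a : R} (hk : k * k' = 1) (hk' : k' * k = 1) (h : k * a = q • (a * k)) :
    k' * a = q⁻¹ • (a * k') := by
  have h1 : k' * (k * a) * k' = k' * (q • (a * k)) * k' := by rw [h]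
  have h2 : a * k' = q • (k' * a) := by
    simpa only [← mul_assoc, hk', one_mul, mul_smul_comm, smul_mul_assoc,
      mul_assoc _ k k', hk, mul_one] using h1
  rw [h2, smul_smul, inv_mul_cancel₀ hq, one_smul]

set_option maxHeartbeats 1000000 in
theorem hidden_symmetry_M2 {R : Type*} [Ring R] [Algebra ℂ R]
    (q : ℂ) (hq : q ≠ 0) (hq2 : q ^ 2 ≠ 1)
    (a₂ d b₁ : ℂ)
    (kA kAinv Ap Am kB kBinv Bp Bm : R)
    (hkA : kA * kAinv = 1) (hkA' : kAinv * kA = 1)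
    (hkB : kB * kBinv = 1) (hkB' : kBinv * kB = 1)
    (hA1 : kA * Ap = q • (Ap * kA))
    (hA2 : kA * Am = q⁻¹ • (Am * kA))
    (hA3 : Am * Ap - Ap * Am = (q - q⁻¹) • (d • kA ^ 2 - a₂ • kAinv ^ 2))
    (hB1 : kB * Bp = q • (Bp * kB))
    (hB2 : kB * Bm = q⁻¹ • (Bm * kB))
    (hB3 : Bm * Bp - Bp * Bm = (q - q⁻¹) • (b₁ • kB ^ 2 - d • kBinv ^ 2))
    (hcomm : ∀ x ∈ ({kA, kAinv, Ap, Am} : Set R),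
             ∀ y ∈ ({kB, kBinv, Bp, Bm} : Set R), Commute x y)
    (ha : a₂ = 0) (hb : b₁ = 0)
    (QA QB : R)
    (hQA : QA = Ap * Am - (d * q⁻¹) • kA ^ 2 - (a₂ * q) • kAinv ^ 2)
    (hQB : QB = Bp * Bm - (b₁ * q⁻¹) • kB ^ 2 - (d * q) • kBinv ^ 2)
    (K₁ K₂ : R)
    (hK1 : K₁ = kAinv * kB)
    (hK2 : K₂ = (Ap * kBinv + Bp * kA) * (Am * kBinv + Bm * kA)
      - (b₁ * q⁻¹) • (kA * kB) ^ 2 - (a₂ * q) • (kAinv * kBinv) ^ 2)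
    (K₃ : R) (hK3 : K₃ = q • (K₁ * K₂) - q⁻¹ • (K₂ * K₁))
    (B : R) (hB : B = ((q - q⁻¹) ^ 2) • (QB * (kA * kB) + QA * (kAinv * kBinv)))
    (D₂ : ℂ) (hD2 : D₂ = (q - q⁻¹) ^ 2 * (q + q⁻¹) * d) :
    q • (K₂ * K₃) - q⁻¹ • (K₃ * K₂) = B * K₂ ∧
    q • (K₃ * K₁) - q⁻¹ • (K₁ * K₃) = B * K₁ + D₂ • (1 : R) := by
  subst ha hb
  have iA1 := inv_mul_of_mul_eq_smul hq hkA hkA' hA1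
  have iA2 := inv_mul_of_mul_eq_smul (inv_ne_zero hq) hkA hkA' hA2
  have iB1 := inv_mul_of_mul_eq_smul hq hkB hkB' hB1
  have iB2 := inv_mul_of_mul_eq_smul (inv_ne_zero hq) hkB hkB' hB2
  have rA : Am * Ap = Ap * Am + ((q - q⁻¹) * d) • (kA * kA) := by
    rw [← sub_eq_iff_eq_add', hA3, zero_smul, sub_zero, smul_smul, pow_two]
  have rB : Bm * Bp = Bp * Bm + (-((q - q⁻¹) * d)) • (kBinv * kBinv) := by
    rw [← sub_eq_iff_eq_add', hB3, zero_smul, zero_sub, smul_neg, smul_smul, pow_two, neg_smul]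
  simp only [Set.mem_insert_iff, Set.mem_singleton_iff, forall_eq_or_imp, forall_eq] at hcomm
  obtain ⟨⟨kA_kB, kA_kBinv, kA_Bp, kA_Bm⟩,
      ⟨kAinv_kB, kAinv_kBinv, kAinv_Bp, kAinv_Bm⟩,
      ⟨Ap_kB, Ap_kBinv, Ap_Bp, Ap_Bm⟩,
      ⟨Am_kB, Am_kBinv, Am_Bp, Am_Bm⟩⟩ := hcomm
  subst hQA hQB hK1 hK2 hK3 hB hD2
  -- Normal ordering: factors of the first triple first, then raising, lowering, `k`, `k⁻¹`.
  constructor <;>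
    simp only [mul_add, add_mul, mul_sub, sub_mul, smul_add, smul_sub, mul_smul_comm,
      smul_mul_assoc, smul_smul, mul_assoc, pow_two, one_mul, mul_one, zero_mul, zero_smul,
      sub_zero, hkA, hkB, hkB', hB1, hB2, iB1, iB2, rB, kA_kBinv.symm.eq, kA_Bp.symm.eq,
      kA_Bm.symm.eq, kAinv_kBinv.symm.eq, kAinv_Bp.symm.eq, kAinv_Bm.symm.eq, mul_mul_eq_of_mul_eq
      hkA, mul_mul_eq_of_mul_eq hkA', mul_mul_eq_of_mul_eq hkB, mul_mul_eq_of_mul_eq hA1,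
      mul_mul_eq_of_mul_eq hA2, mul_mul_eq_of_mul_eq hB1, mul_mul_eq_of_mul_eq hB2,
      mul_mul_eq_of_mul_eq iA1, mul_mul_eq_of_mul_eq iA2, mul_mul_eq_of_mul_eq iB1,
      mul_mul_eq_of_mul_eq iB2, mul_mul_eq_of_mul_eq rA, mul_mul_eq_of_mul_eq rB,
      mul_mul_eq_of_mul_eq kA_kB.symm.eq, mul_mul_eq_of_mul_eq kA_kBinv.symm.eq,
      mul_mul_eq_of_mul_eq kA_Bp.symm.eq, mul_mul_eq_of_mul_eq kA_Bm.symm.eq, mul_mul_eq_of_mul_eq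
      kAinv_kB.symm.eq, mul_mul_eq_of_mul_eq kAinv_kBinv.symm.eq, mul_mul_eq_of_mul_eq
      kAinv_Bp.symm.eq, mul_mul_eq_of_mul_eq kAinv_Bm.symm.eq, mul_mul_eq_of_mul_eq Ap_kB.symm.eq,
      mul_mul_eq_of_mul_eq Ap_kBinv.symm.eq, mul_mul_eq_of_mul_eq Ap_Bp.symm.eq,
      mul_mul_eq_of_mul_eq Ap_Bm.symm.eq, mul_mul_eq_of_mul_eq Am_kB.symm.eq, mul_mul_eq_of_mul_eq
      Am_kBinv.symm.eq, mul_mul_eq_of_mul_eq Am_Bp.symm.eq, mul_mul_eq_of_mul_eq Am_Bm.symm.eq] <;>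
    match_scalars <;> field_simp <;> ring
end

section
/- For every N ∈ ℕ, the (N+1)-dimensional subspace V_N = span{eₙ ⊗ f_{N−n} : 0 ≤ n ≤ N} of V_a ⊗ V_b (the eigenspace of the total number operator C₀ = A₀ + B₀) is invariant under the total Casimir operator Q_C. -/
/-- The tensor product `V_a ⊗ V_b` of two complex vector spaces with bases
`(eₙ)` and `(fₘ)` is modelled by its product basis: `V = (ℕ × ℕ) →₀ ℂ`,
with `eₙ ⊗ fₘ := Finsupp.single (n, m) 1`. -/
noncomputable def tensorOp (g : ℕ × ℕ → ((ℕ × ℕ) →₀ ℂ)) :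
    Module.End ℂ ((ℕ × ℕ) →₀ ℂ) :=
  Finsupp.lsum ℂ fun p => LinearMap.toSpanSingleton ℂ ((ℕ × ℕ) →₀ ℂ) (g p)

@[simp]
theorem tensorOp_single (g : ℕ × ℕ → ((ℕ × ℕ) →₀ ℂ)) (p : ℕ × ℕ) :
    tensorOp g (Finsupp.single p 1) = g p := by
  simp [tensorOp]

theorem casimir_preserves_eigenspace (q wa wb : ℂ) (hq : q ≠ 0) (hq2 : q ^ 2 ≠ 1)
    (hwa : wa ≠ 0) (hwb : wb ≠ 0)
    (a₂ d b₁ : ℂ) (ra rb : ℕ → ℂ) (hra0 : ra 0 = 0) (hrb0 : rb 0 = 0)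
    (hra : ∀ n : ℕ, (ra n) ^ 2
      = (q ^ n - (q⁻¹) ^ n) * (d * q ^ n * q⁻¹ * wa ^ 2 - a₂ * q * (q⁻¹) ^ n * (wa⁻¹) ^ 2))
    (hrb : ∀ n : ℕ, (rb n) ^ 2
      = (q ^ n - (q⁻¹) ^ n) * (b₁ * q ^ n * q⁻¹ * wb ^ 2 - d * q * (q⁻¹) ^ n * (wb⁻¹) ^ 2))
    (kA kAinv Ap Am kB kBinv Bp Bm : Module.End ℂ ((ℕ × ℕ) →₀ ℂ))
    (hkA : kA = tensorOp fun p => (q ^ p.1 * wa) • Finsupp.single p 1)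
    (hkAinv : kAinv = tensorOp fun p => (q ^ p.1 * wa)⁻¹ • Finsupp.single p 1)
    (hAp : Ap = tensorOp fun p => ra (p.1 + 1) • Finsupp.single (p.1 + 1, p.2) 1)
    (hAm : Am = tensorOp fun p =>
      if p.1 = 0 then 0 else ra p.1 • Finsupp.single (p.1 - 1, p.2) 1)
    (hkB : kB = tensorOp fun p => (q ^ p.2 * wb) • Finsupp.single p 1)
    (hkBinv : kBinv = tensorOp fun p => (q ^ p.2 * wb)⁻¹ • Finsupp.single p 1)
    (hBp : Bp = tensorOp fun p => rb (p.2 + 1) • Finsupp.single (p.1, p.2 + 1) 1)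
    (hBm : Bm = tensorOp fun p =>
      if p.2 = 0 then 0 else rb p.2 • Finsupp.single (p.1, p.2 - 1) 1)
    (QC : Module.End ℂ ((ℕ × ℕ) →₀ ℂ))
    (hQC : QC = (Ap * kBinv + Bp * kA) * (Am * kBinv + Bm * kA)
      - (b₁ * q⁻¹) • (kA * kB) ^ 2 - (a₂ * q) • (kAinv * kBinv) ^ 2)
    (N : ℕ) :
    ∀ v ∈ Submodule.span ℂ {x : (ℕ × ℕ) →₀ ℂ | ∃ n ≤ N, x = Finsupp.single (n, N - n) 1},
      QC v ∈ Submodule.span ℂ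
        {x : (ℕ × ℕ) →₀ ℂ | ∃ n ≤ N, x = Finsupp.single (n, N - n) 1} := by
  intro v hv
  set S := Submodule.span ℂ {x : (ℕ × ℕ) →₀ ℂ | ∃ n ≤ N, x = Finsupp.single (n, N - n) 1}
    with hS
  have mem : ∀ i j, i + j = N → (Finsupp.single (i, j) 1 : (ℕ × ℕ) →₀ ℂ) ∈ S := by
    intro i j hij
    exact Submodule.subset_span ⟨i, by omega, by rw [← hij, Nat.add_sub_cancel_left]⟩
  have ladder : ∀ i j, i + j = N → Ap (kBinv (Am (kBinv (Finsupp.single (i, j) 1)))) ∈ S ∧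
      Ap (kBinv (Bm (kA (Finsupp.single (i, j) 1)))) ∈ S ∧
      Bp (kA (Am (kBinv (Finsupp.single (i, j) 1)))) ∈ S ∧
      Bp (kA (Bm (kA (Finsupp.single (i, j) 1)))) ∈ S := by
    intro i j hij
    subst hkA hAp hAm hkBinv hBp hBm
    refine ⟨?_, ?_, ?_, ?_⟩ <;> rcases i with _ | i <;> rcases j with _ | j <;>
      simp only [tensorOp_single, map_smul, map_zero, smul_zero, if_true, Nat.add_eq_zero_iff,
        one_ne_zero, and_false, if_false, Nat.add_sub_cancel, S.zero_mem] <;>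
      (repeat' apply S.smul_mem) <;> exact mem _ _ (by omega)
  have diag : ∀ i j, i + j = N → kA (kB (kA (kB (Finsupp.single (i, j) 1)))) ∈ S ∧
      kAinv (kBinv (kAinv (kBinv (Finsupp.single (i, j) 1)))) ∈ S := by
    intro i j hij
    subst hkA hkB hkAinv hkBinv
    simp only [tensorOp_single, map_smul]
    constructor <;> (repeat' apply S.smul_mem) <;> exact mem _ _ hij
  have invariant : S ≤ S.comap QC := by
    rw [hS, Submodule.span_le, ← hS]
    rintro _ ⟨n, hn, rfl⟩
    have hnN : n + (N - n) = N := by omega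
    obtain ⟨h₁, h₂, h₃, h₄⟩ := ladder n (N - n) hnN
    obtain ⟨h₅, h₆⟩ := diag n (N - n) hnN
    simp only [hQC, SetLike.mem_coe, Submodule.mem_comap, LinearMap.sub_apply,
      LinearMap.smul_apply, pow_two, Module.End.mul_apply, LinearMap.add_apply, map_add]
    exact S.sub_mem (S.sub_mem
      (S.add_mem (S.add_mem h₁ h₃) (S.add_mem h₂ h₄))
      (S.smul_mem _ h₅)) (S.smul_mem _ h₆)
  exact invariant hv
end
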